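/- arXiv:0812.2291 — 5 statements merged into one kernel-verified Lean document; each statement's English description precedes it below -/
import Mathlib

section
/- Consider the naive MAB mechanism with k agents and time horizon T: in the exploration phase each agent is played for T_0 = ⌈k^{−2/3} · T^{2/3} · (log T)^{1/3}⌉ rounds in round-robin fashion; letting c_i denote the number of clicks agent i receives during exploration, an agent i* maximizing c_i b_i is played in every remaining round (exploitation phase); agent i* pays (max_{j ≠ i*} c_j b_j)/c_{i*} for each click she receives in the exploitation phase, and every other payment is 0 (exploration rounds are free). This mechanism is normalized and truthful, and there is an absolute constant C such that for all k ≥ 2, T ≥ 2 and v_max > 0 its worst-case regret in the stochastic setting satisfies R(T; v_max) ≤ C · v_max · k^{1/3} · T^{2/3} · (log T)^{2/3}. -/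
open Finset

namespace MAB

/-- A realization of clicks: for each agent and each round, whether the agent
would be clicked if shown at that round. -/
abbrev Realization (k T : ℕ) := Fin k → Fin T → Bool

/-- A deterministic allocation rule: maps a bid profile, a realization and a round
to the agent chosen at that round. -/
abbrev Alloc (k T : ℕ) := (Fin k → ℝ) → Realization k T → Fin T → Fin k

/-- A payment rule: maps a bid profile and a realization to the payment
charged to each agent. -/
abbrev Payment (k T : ℕ) := (Fin k → ℝ) → Realization k T → Fin k → ℝ

variable {k T : ℕ}

/-- A bid profile consists of positive reals. -/
def PosBids (b : Fin k → ℝ) : Prop := ∀ i, 0 < b i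

/-- The allocation rule is online: the choice at round `t` is determined by the bids
and the bits observed at rounds `s < t`. -/
def Online (A : Alloc k T) : Prop :=
  ∀ (b : Fin k → ℝ) (ρ ρ' : Realization k T) (t : Fin T),
    (∀ s : Fin T, s < t → ρ (A b ρ s) s = ρ' (A b ρ s) s) → A b ρ t = A b ρ' t

/-- The click-allocation: the number of rounds in which agent `i` is chosen and clicked. -/
def clicks (A : Alloc k T) (b : Fin k → ℝ) (ρ : Realization k T) (i : Fin k) : ℕ :=
  (univ.filter fun t : Fin T => A b ρ t = i ∧ ρ i t = true).card

/-- The payment rule only uses clicks actually observed by the allocation rule. -/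
def PaymentObservable (A : Alloc k T) (P : Payment k T) : Prop :=
  ∀ (b : Fin k → ℝ) (ρ ρ' : Realization k T),
    (∀ t : Fin T, ρ (A b ρ t) t = ρ' (A b ρ t) t) → P b ρ = P b ρ'

/-- The mechanism is normalized: `0 ≤ P_i(b;ρ) ≤ b_i · C_i(b;ρ)`. -/
def Normalized (A : Alloc k T) (P : Payment k T) : Prop :=
  ∀ (b : Fin k → ℝ) (ρ : Realization k T) (i : Fin k), PosBids b →
    0 ≤ P b ρ i ∧ P b ρ i ≤ b i * (clicks A b ρ i : ℝ)

/-- The mechanism is truthful: bidding the true value dominates any other bid. -/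
def Truthful (A : Alloc k T) (P : Payment k T) : Prop :=
  ∀ (b : Fin k → ℝ) (ρ : Realization k T) (i : Fin k) (v : ℝ), PosBids b → 0 < v →
    v * (clicks A (Function.update b i v) ρ i : ℝ) - P (Function.update b i v) ρ i ≥
      v * (clicks A b ρ i : ℝ) - P b ρ i

/-- Pointwise monotonicity: an agent that is played keeps the impression
after increasing her bid. -/
def PointwiseMonotone (A : Alloc k T) : Prop :=
  ∀ (b : Fin k → ℝ) (ρ : Realization k T) (t : Fin T) (i : Fin k) (x : ℝ),
    PosBids b → A b ρ t = i → b i < x → A (Function.update b i x) ρ t = i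

/-- `flip ρ i t` is `ρ ⊕ 1(i,t)`: the realization with the bit of agent `i`
at round `t` flipped. -/
def flip (ρ : Realization k T) (i : Fin k) (t : Fin T) : Realization k T :=
  fun j s => if j = i ∧ s = t then !(ρ j s) else ρ j s

/-- Round `t` is `(b;ρ)`-influential. -/
def InfluentialAt (A : Alloc k T) (b : Fin k → ℝ) (ρ : Realization k T) (t : Fin T) : Prop :=
  ∃ t' : Fin T, t < t' ∧ A b ρ t' ≠ A b (flip ρ (A b ρ t) t) t'

/-- Round `t` is influential for realization `ρ`. -/
def Influential (A : Alloc k T) (ρ : Realization k T) (t : Fin T) : Prop :=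
  ∃ b : Fin k → ℝ, PosBids b ∧ InfluentialAt A b ρ t

/-- The allocation rule is exploration-separated: in any influential round
the allocation does not depend on the bids. -/
def ExplorationSeparated (A : Alloc k T) : Prop :=
  ∀ (ρ : Realization k T) (t : Fin T), Influential A ρ t →
    ∀ b b' : Fin k → ℝ, PosBids b → PosBids b' → A b ρ t = A b' ρ t

/-- Round `t` is `(b;ρ)`-influential with influenced agent `i`. -/
def InfluencedAgent (A : Alloc k T) (b : Fin k → ℝ) (ρ : Realization k T) (t : Fin T)
    (i : Fin k) : Prop :=
  ∃ t' : Fin T, t < t' ∧ A b ρ t' ≠ A b (flip ρ (A b ρ t) t) t' ∧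
    (i = A b ρ t' ∨ i = A b (flip ρ (A b ρ t) t) t')

/-- Round `t` is `(b;ρ)`-secured from agent `i`. -/
def SecuredFrom (A : Alloc k T) (b : Fin k → ℝ) (ρ : Realization k T) (t : Fin T)
    (i : Fin k) : Prop :=
  ∀ x : ℝ, b i < x → A (Function.update b i x) ρ t = A b ρ t

/-- The allocation rule is weakly separated. -/
def WeaklySeparated (A : Alloc k T) : Prop :=
  ∀ (b : Fin k → ℝ) (ρ : Realization k T) (t : Fin T) (i : Fin k),
    PosBids b → InfluencedAgent A b ρ t i → SecuredFrom A b ρ t i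

/-- Non-degeneracy of the allocation rule. -/
def NonDegenerate (A : Alloc k T) : Prop :=
  ∀ (b : Fin k → ℝ) (ρ : Realization k T) (t t' : Fin T), PosBids b → t ≤ t' →
    ∃ l u : ℝ, l < u ∧ l ≤ b (A b ρ t) ∧ b (A b ρ t) ≤ u ∧
      ∀ x ∈ Set.Icc l u, ∀ φ ∈ ({ρ, flip ρ (A b ρ t) t} : Set (Realization k T)),
        ∀ s ∈ ({t, t'} : Set (Fin T)),
          (A (Function.update b (A b ρ t) x) φ s = A b ρ t ↔ A b φ s = A b ρ t)

/-- The allocation rule is scale-free. -/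
def ScaleFree (A : Alloc k T) : Prop :=
  ∀ (c : ℝ) (b : Fin k → ℝ) (ρ : Realization k T) (t : Fin T), 0 < c → PosBids b →
    A (fun j => c * b j) ρ t = A b ρ t

/-- Independence of irrelevant alternatives. -/
def IIA (A : Alloc k T) : Prop :=
  ∀ (b : Fin k → ℝ) (ρ : Realization k T) (t : Fin T) (i : Fin k) (x : ℝ),
    PosBids b → 0 < x → A b ρ t ≠ A (Function.update b i x) ρ t →
    (A b ρ t = i ∨ A (Function.update b i x) ρ t = i)

/-- Round `t` is bid-independent w.r.t. realization `ρ`. -/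
def BidIndependent (A : Alloc k T) (ρ : Realization k T) (t : Fin T) : Prop :=
  ∀ b b' : Fin k → ℝ, PosBids b → PosBids b' → A b ρ t = A b' ρ t

/-- The probability of realization `ρ` when clicks are independent Bernoulli
with CTR vector `μ`. -/
noncomputable def prob (μ : Fin k → ℝ) (ρ : Realization k T) : ℝ :=
  ∏ i : Fin k, ∏ t : Fin T, if ρ i t then μ i else 1 - μ i

/-- A valid CTR vector: all entries in `[0,1]`. -/
def ValidCTR (μ : Fin k → ℝ) : Prop := ∀ i, 0 ≤ μ i ∧ μ i ≤ 1

/-- A valid value profile: all values in `(0, vmax]`. -/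
def ValidValues (vmax : ℝ) (v : Fin k → ℝ) : Prop := ∀ i, 0 < v i ∧ v i ≤ vmax

/-- The regret of allocation rule `A` on the instance with CTRs `μ` and values `v`
(bids equal to the true values). -/
noncomputable def regret (A : Alloc k T) (μ v : Fin k → ℝ) : ℝ :=
  (T : ℝ) * (⨆ i : Fin k, μ i * v i) -
    ∑ ρ : Realization k T, prob μ ρ * ∑ t : Fin T, μ (A v ρ t) * v (A v ρ t)

/-- The worst-case regret `R(T; vmax)`. -/
noncomputable def worstRegret (A : Alloc k T) (vmax : ℝ) : ℝ :=
  sSup {r : ℝ | ∃ μ v : Fin k → ℝ, ValidCTR μ ∧ ValidValues vmax v ∧ r = regret A μ v}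

/-- The instance `(μ, v)` has `δ`-gap: the largest product `μ_i v_i` exceeds
the second largest by `δ · max_i v_i`. -/
def HasGap (μ v : Fin k → ℝ) (δ : ℝ) : Prop :=
  ∃ i : Fin k, (∀ j, μ j * v j ≤ μ i * v i) ∧
    μ i * v i - (⨆ j : {j : Fin k // j ≠ i}, μ j.1 * v j.1) = δ * (⨆ j : Fin k, v j)

/-- The worst-case regret over `δ`-gap instances, `R_δ(T; vmax)`. -/
noncomputable def worstGapRegret (A : Alloc k T) (vmax δ : ℝ) : ℝ :=
  sSup {r : ℝ | ∃ μ v : Fin k → ℝ,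
    ValidCTR μ ∧ ValidValues vmax v ∧ HasGap μ v δ ∧ r = regret A μ v}

/-- The exploration-phase length `T₀` of the naive mechanism. -/
noncomputable def naiveT0 (k T : ℕ) : ℕ :=
  ⌈(T : ℝ) ^ ((2 : ℝ) / 3) * (Real.log T) ^ ((1 : ℝ) / 3) / (k : ℝ) ^ ((2 : ℝ) / 3)⌉₊

/-- Number of clicks received by agent `i` during the (round-robin) exploration phase. -/
def explClicks (T0 : ℕ) (ρ : Realization k T) (i : Fin k) : ℕ :=
  (univ.filter fun t : Fin T => t.val < k * T0 ∧ t.val % k = i.val ∧ ρ i t = true).card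

/-- Number of clicks received by agent `i` during the exploitation phase. -/
def exploitClicks (A : Alloc k T) (T0 : ℕ) (b : Fin k → ℝ) (ρ : Realization k T)
    (i : Fin k) : ℕ :=
  (univ.filter fun t : Fin T => k * T0 ≤ t.val ∧ A b ρ t = i ∧ ρ i t = true).card

section Naive

/-- An agent with the largest score. -/
noncomputable def argmaxScore [NeZero k] (w : Fin k → ℝ) : Fin k :=
  (Finite.exists_max w).choose

/-- The agent with the best empirical score `c_j b_j` after exploration. -/
noncomputable def naiveWinner [NeZero k] (T0 : ℕ) (b : Fin k → ℝ) (ρ : Realization k T) : Fin k :=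
  argmaxScore fun j => (explClicks T0 ρ j : ℝ) * b j

/-- Round-robin for `k * T0` rounds, then the empirically best agent. -/
noncomputable def naiveAlloc [NeZero k] (T0 : ℕ) : Alloc k T := fun b ρ t =>
  if t.val < k * T0 then Fin.ofNat k t.val else naiveWinner T0 b ρ

/-- The largest empirical score among the competitors of agent `i`. -/
noncomputable def runnerUp (T0 : ℕ) (b : Fin k → ℝ) (ρ : Realization k T) (i : Fin k) : ℝ :=
  ⨆ j : {j : Fin k // j ≠ i}, (explClicks T0 ρ j.1 : ℝ) * b j.1

/-- The winner pays `runnerUp / c_i` for each click of the exploitation phase. -/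
noncomputable def naivePayment [NeZero k] (T0 : ℕ) : Payment k T := fun b ρ i =>
  if i = naiveWinner T0 b ρ then
    runnerUp T0 b ρ i / (explClicks T0 ρ i : ℝ) *
      (exploitClicks (naiveAlloc T0) T0 b ρ i : ℝ)
  else 0

/-- Number of clicks agent `i` would receive if played throughout the exploitation phase. -/
def potentialClicks (T0 : ℕ) (ρ : Realization k T) (i : Fin k) : ℕ :=
  (univ.filter fun t : Fin T => k * T0 ≤ t.val ∧ ρ i t = true).card

variable (T0 : ℕ)

lemma runnerUp_nonneg {b : Fin k → ℝ} (hb : PosBids b) (ρ : Realization k T) (i : Fin k) :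
    0 ≤ runnerUp T0 b ρ i :=
  Real.iSup_nonneg fun j => mul_nonneg (Nat.cast_nonneg _) (hb j.1).le

lemma le_runnerUp (b : Fin k → ℝ) (ρ : Realization k T) {i j : Fin k} (h : j ≠ i) :
    (explClicks T0 ρ j : ℝ) * b j ≤ runnerUp T0 b ρ i :=
  le_ciSup (f := fun j : {j : Fin k // j ≠ i} => (explClicks T0 ρ j.1 : ℝ) * b j.1)
    (Set.finite_range _).bddAbove ⟨j, h⟩

lemma runnerUp_update (b : Fin k → ℝ) (ρ : Realization k T) (i : Fin k) (x : ℝ) :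
    runnerUp T0 (Function.update b i x) ρ i = runnerUp T0 b ρ i := by
  unfold runnerUp
  congr 1
  funext j
  rw [Function.update_of_ne j.2]

variable [NeZero k]

lemma le_argmaxScore (w : Fin k → ℝ) (j : Fin k) : w j ≤ w (argmaxScore w) :=
  (Finite.exists_max w).choose_spec j

lemma score_le_naiveWinner (b : Fin k → ℝ) (ρ : Realization k T) (j : Fin k) :
    (explClicks T0 ρ j : ℝ) * b j ≤
      (explClicks T0 ρ (naiveWinner T0 b ρ) : ℝ) * b (naiveWinner T0 b ρ) :=
  le_argmaxScore (fun j => (explClicks T0 ρ j : ℝ) * b j) j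

lemma naiveAlloc_of_lt (b : Fin k → ℝ) (ρ : Realization k T) {t : Fin T}
    (ht : t.val < k * T0) : naiveAlloc T0 b ρ t = Fin.ofNat k t.val := if_pos ht

lemma naiveAlloc_of_le (b : Fin k → ℝ) (ρ : Realization k T) {t : Fin T}
    (ht : k * T0 ≤ t.val) : naiveAlloc T0 b ρ t = naiveWinner T0 b ρ := if_neg ht.not_gt

lemma ofNat_eq_iff (n : ℕ) (i : Fin k) : Fin.ofNat k n = i ↔ n % k = i.val := by
  rw [Fin.ext_iff]; rfl

lemma explClicks_congr {b : Fin k → ℝ} {ρ ρ' : Realization k T}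
    (h : ∀ s : Fin T, s.val < k * T0 → ρ (naiveAlloc T0 b ρ s) s = ρ' (naiveAlloc T0 b ρ s) s)
    (i : Fin k) : explClicks T0 ρ i = explClicks T0 ρ' i := by
  unfold explClicks
  congr 1
  refine filter_congr fun t _ => and_congr_right fun ht => and_congr_right fun hi => ?_
  have := h t ht
  rw [naiveAlloc_of_lt T0 b ρ ht, (ofNat_eq_iff _ _).2 hi] at this
  rw [this]

lemma naiveWinner_congr {b : Fin k → ℝ} {ρ ρ' : Realization k T}
    (h : ∀ i, explClicks T0 ρ i = explClicks T0 ρ' i) :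
    naiveWinner T0 b ρ = naiveWinner T0 b ρ' := by
  unfold naiveWinner; simp_rw [h]

lemma naiveAlloc_online : Online (naiveAlloc (k := k) (T := T) T0) := by
  intro b ρ ρ' t h
  by_cases ht : t.val < k * T0
  · rw [naiveAlloc_of_lt T0 b ρ ht, naiveAlloc_of_lt T0 b ρ' ht]
  · rw [not_lt] at ht
    rw [naiveAlloc_of_le T0 b ρ ht, naiveAlloc_of_le T0 b ρ' ht]
    exact naiveWinner_congr T0 (explClicks_congr T0 fun s hs => h s (Fin.lt_def.2 (by omega)))

lemma exploitClicks_naiveAlloc (b : Fin k → ℝ) (ρ : Realization k T) (i : Fin k) :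
    exploitClicks (naiveAlloc T0) T0 b ρ i =
      if i = naiveWinner T0 b ρ then potentialClicks T0 ρ i else 0 := by
  unfold exploitClicks potentialClicks
  split_ifs with hi
  · congr 1
    refine filter_congr fun t _ => and_congr_right fun ht => ?_
    rw [naiveAlloc_of_le T0 b ρ ht]
    simp [hi.symm]
  · rw [card_eq_zero, filter_eq_empty_iff]
    rintro t - ⟨ht, hA, -⟩
    rw [naiveAlloc_of_le T0 b ρ ht] at hA
    exact hi hA.symm

lemma clicks_naiveAlloc (b : Fin k → ℝ) (ρ : Realization k T) (i : Fin k) :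
    clicks (naiveAlloc T0) b ρ i =
      explClicks T0 ρ i + exploitClicks (naiveAlloc T0) T0 b ρ i := by
  unfold clicks explClicks exploitClicks
  rw [← card_union_of_disjoint]
  · congr 1
    ext t
    simp only [mem_filter, mem_univ, true_and, mem_union]
    by_cases ht : t.val < k * T0
    · rw [naiveAlloc_of_lt T0 b ρ ht, ofNat_eq_iff]
      simp [ht]
    · simp [ht, not_lt.1 ht]
  · rw [disjoint_filter]
    rintro t - ⟨h1, -⟩ ⟨h2, -⟩
    omega

lemma naivePayment_observable :
    PaymentObservable (naiveAlloc (k := k) (T := T) T0) (naivePayment T0) := by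
  intro b ρ ρ' h
  have hc : ∀ i, explClicks T0 ρ i = explClicks T0 ρ' i :=
    explClicks_congr T0 fun s _ => h s
  have hw : naiveWinner T0 b ρ = naiveWinner T0 b ρ' := naiveWinner_congr T0 hc
  funext i
  unfold naivePayment runnerUp
  rw [← hw]
  split_ifs with hi
  · simp_rw [hc]
    congr 2
    unfold exploitClicks
    congr 1
    refine filter_congr fun t _ => and_congr_right fun ht => ?_
    have := h t
    rw [naiveAlloc_of_le T0 b ρ ht] at this ⊢
    rw [naiveAlloc_of_le T0 b ρ' ht, ← hw]
    refine and_congr_right fun hi => ?_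
    rw [← hi, this]
  · rfl

lemma runnerUp_le_winner {b : Fin k → ℝ} (hb : PosBids b) (ρ : Realization k T) :
    runnerUp T0 b ρ (naiveWinner T0 b ρ) ≤
      (explClicks T0 ρ (naiveWinner T0 b ρ) : ℝ) * b (naiveWinner T0 b ρ) :=
  Real.iSup_le (fun j => score_le_naiveWinner T0 b ρ j.1)
    (mul_nonneg (Nat.cast_nonneg _) (hb _).le)

/-- The price per click does not exceed the bid of the winner. -/
lemma price_le_bid {b : Fin k → ℝ} (hb : PosBids b) (ρ : Realization k T) :
    runnerUp T0 b ρ (naiveWinner T0 b ρ) / (explClicks T0 ρ (naiveWinner T0 b ρ) : ℝ) ≤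
      b (naiveWinner T0 b ρ) :=
  div_le_of_le_mul₀ (Nat.cast_nonneg _) (hb _).le
    ((runnerUp_le_winner T0 hb ρ).trans_eq (mul_comm _ _))

lemma naivePayment_normalized :
    Normalized (naiveAlloc (k := k) (T := T) T0) (naivePayment T0) := by
  intro b ρ i hb
  have hbi := hb i
  rw [clicks_naiveAlloc]
  unfold naivePayment
  split_ifs with hi
  · refine ⟨mul_nonneg (div_nonneg (runnerUp_nonneg T0 hb ρ i) (Nat.cast_nonneg _))
      (Nat.cast_nonneg _), ?_⟩
    refine mul_le_mul ?_ ?_ (Nat.cast_nonneg _) hbi.le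
    · rw [hi]
      exact price_le_bid T0 hb ρ
    · exact_mod_cast Nat.le_add_left _ _
  · exact ⟨le_rfl, by positivity⟩

lemma naive_utility (b : Fin k → ℝ) (ρ : Realization k T) (i : Fin k) (v : ℝ) :
    v * (clicks (naiveAlloc T0) b ρ i : ℝ) - naivePayment T0 b ρ i =
      v * (explClicks T0 ρ i : ℝ) +
        if i = naiveWinner T0 b ρ then
          (v - runnerUp T0 b ρ i / (explClicks T0 ρ i : ℝ)) * (potentialClicks T0 ρ i : ℝ)
        else 0 := by
  rw [clicks_naiveAlloc]
  unfold naivePayment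
  rw [exploitClicks_naiveAlloc]
  split_ifs with hi
  · push_cast; ring
  · simp

lemma naive_truthful :
    Truthful (naiveAlloc (k := k) (T := T) T0) (naivePayment T0) := by
  intro b ρ i v hb hv
  have hb' : PosBids (Function.update b i v) := by
    intro j
    rcases eq_or_ne j i with rfl | hj
    · simpa using hv
    · simpa [hj] using hb j
  rw [ge_iff_le, naive_utility, naive_utility, runnerUp_update]
  refine add_le_add le_rfl ?_
  by_cases hw : i = naiveWinner T0 (Function.update b i v) ρ
  · have hp := price_le_bid T0 hb' ρ
    rw [← hw, runnerUp_update, Function.update_self] at hp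
    rw [if_pos hw]
    split_ifs
    · exact le_rfl
    · exact mul_nonneg (sub_nonneg.2 hp) (Nat.cast_nonneg _)
  · rw [if_neg hw]
    split_ifs with hi
    · refine mul_nonpos_of_nonpos_of_nonneg (sub_nonpos.2 ?_) (Nat.cast_nonneg _)
      rcases (explClicks T0 ρ i).eq_zero_or_pos with h0 | hpos
      · refine absurd (hi.trans ?_) hw
        unfold naiveWinner
        congr 1
        funext j
        rcases eq_or_ne j i with rfl | hj
        · simp [h0]
        · rw [Function.update_of_ne hj]
      · rw [le_div_iff₀ (Nat.cast_pos.2 hpos), mul_comm]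
        have h1 := score_le_naiveWinner T0 (Function.update b i v) ρ i
        have h2 := le_runnerUp T0 (Function.update b i v) ρ (Ne.symm hw)
        rw [runnerUp_update] at h2
        rw [Function.update_self] at h1
        exact h1.trans h2
    · exact le_rfl

end Naive

section Concentration

lemma sum_prob_mul_prod (μ : Fin k → ℝ) (g : Fin k → Fin T → Bool → ℝ) :
    ∑ ρ : Realization k T, prob μ ρ * ∏ i, ∏ t, g i t (ρ i t) =
      ∏ i, ∏ t, (μ i * g i t true + (1 - μ i) * g i t false) := by
  have h : ∀ i t, μ i * g i t true + (1 - μ i) * g i t false =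
      ∑ x : Bool, (if x then μ i else 1 - μ i) * g i t x := by
    intro i t; simp
  simp_rw [h, prod_univ_sum, Fintype.piFinset_univ, prob, ← prod_mul_distrib]

lemma sum_prob (μ : Fin k → ℝ) : ∑ ρ : Realization k T, prob μ ρ = 1 := by
  simpa using sum_prob_mul_prod (T := T) μ fun _ _ _ => 1

lemma prob_nonneg {μ : Fin k → ℝ} (hμ : ValidCTR μ) (ρ : Realization k T) : 0 ≤ prob μ ρ := by
  refine prod_nonneg fun i _ => prod_nonneg fun t _ => ?_
  have := hμ i
  split_ifs <;> linarith

/-- The rounds at which agent `i` is explored. -/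
def explRounds (T T0 : ℕ) (i : Fin k) : Finset (Fin T) :=
  univ.filter fun t : Fin T => t.val < k * T0 ∧ t.val % k = i.val

lemma card_explRounds {T0 : ℕ} (h : k * T0 ≤ T) (i : Fin k) :
    (explRounds T T0 i).card = T0 := by
  have hlt : ∀ m ∈ range T0, k * m + i.val < k * T0 := by
    intro m hm
    have h1 : k * (m + 1) ≤ k * T0 := Nat.mul_le_mul_left k (mem_range.1 hm)
    have h2 := i.isLt
    rw [Nat.mul_add] at h1
    omega
  conv_rhs => rw [← card_range T0]
  symm
  refine card_bij (fun m hm => ⟨k * m + i.val, (hlt m hm).trans_le h⟩) ?_ ?_ ?_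
  · intro m hm
    simp [explRounds, hlt m hm, Nat.mod_eq_of_lt i.isLt]
  · intro m _ m' _ hmm
    have h1 : k * m + i.val = k * m' + i.val := congrArg Fin.val hmm
    exact Nat.eq_of_mul_eq_mul_left i.pos (Nat.add_right_cancel h1)
  · intro t ht
    obtain ⟨h1, h2⟩ := (mem_filter.1 ht).2
    refine ⟨t.val / k, mem_range.2 (Nat.div_lt_of_lt_mul h1), Fin.ext ?_⟩
    change k * (t.val / k) + i.val = t.val
    rw [← h2]
    exact Nat.div_add_mod _ _

lemma explClicks_eq (T0 : ℕ) (ρ : Realization k T) (i : Fin k) :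
    explClicks T0 ρ i = ((explRounds T T0 i).filter fun t => ρ i t = true).card := by
  unfold explClicks explRounds
  rw [filter_filter]
  simp only [and_assoc]

lemma sum_prob_mul_prod_explRounds {T0 : ℕ} (h : k * T0 ≤ T) (μ : Fin k → ℝ) (i : Fin k)
    (f : Bool → ℝ) :
    ∑ ρ : Realization k T, prob μ ρ * ∏ t ∈ explRounds T T0 i, f (ρ i t) =
      (μ i * f true + (1 - μ i) * f false) ^ T0 := by
  have key := sum_prob_mul_prod (T := T) μ fun j t x =>
    if j = i ∧ t ∈ explRounds T T0 i then f x else 1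
  have hrow : ∀ (g : Fin k → Fin T → ℝ),
      (∏ j, ∏ t, if j = i ∧ t ∈ explRounds T T0 i then g j t else 1) =
        ∏ t ∈ explRounds T T0 i, g i t := by
    intro g
    rw [prod_eq_single i (fun j _ hj => by simp [hj]) (by simp)]
    simp [prod_ite_mem]
  have hR : ∀ (j : Fin k) (t : Fin T),
      (μ j * (if j = i ∧ t ∈ explRounds T T0 i then f true else 1) +
        (1 - μ j) * (if j = i ∧ t ∈ explRounds T T0 i then f false else 1)) =
      if j = i ∧ t ∈ explRounds T T0 i then μ j * f true + (1 - μ j) * f false else 1 := by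
    intro j t
    split_ifs <;> ring
  simp_rw [hR] at key
  rw [hrow fun j _ => μ j * f true + (1 - μ j) * f false, prod_const, card_explRounds h] at key
  rw [← key]
  exact sum_congr rfl fun ρ _ => by rw [hrow fun j t => f (ρ j t)]

lemma sum_prob_mul_exp_explClicks {T0 : ℕ} (h : k * T0 ≤ T) (μ : Fin k → ℝ) (i : Fin k) (s : ℝ) :
    ∑ ρ : Realization k T, prob μ ρ * Real.exp (s * explClicks T0 ρ i) =
      (μ i * Real.exp s + (1 - μ i)) ^ T0 := by
  have key := sum_prob_mul_prod_explRounds h μ i fun x => if x then Real.exp s else 1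
  simp only [if_true, Bool.false_eq_true, if_false, mul_one] at key
  rw [← key]
  refine sum_congr rfl fun ρ _ => ?_
  rw [explClicks_eq, mul_comm s, Real.exp_nat_mul, ← prod_filter, prod_const]

lemma bernoulli_mgf_le {p s : ℝ} (hp0 : 0 ≤ p) (hp1 : p ≤ 1) (hs : |s| ≤ 1) :
    p * Real.exp s + (1 - p) ≤ Real.exp (p * s + s ^ 2) := by
  have h1 := (abs_le.1 (Real.abs_exp_sub_one_sub_id_le hs)).2
  have h2 := Real.add_one_le_exp (p * s + s ^ 2)
  nlinarith [mul_le_mul_of_nonneg_left h1 hp0, mul_nonneg (sub_nonneg.2 hp1) (sq_nonneg s)]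

lemma sum_prob_mul_exp_deviation_le {T0 : ℕ} (h : k * T0 ≤ T) {μ : Fin k → ℝ} (hμ : ValidCTR μ)
    (i : Fin k) {s : ℝ} (hs : |s| ≤ 1) (r : ℝ) :
    ∑ ρ : Realization k T, prob μ ρ * Real.exp (s * (explClicks T0 ρ i - T0 * μ i) - r) ≤
      Real.exp (T0 * s ^ 2 - r) := by
  have e : ∀ ρ : Realization k T,
      prob μ ρ * Real.exp (s * (explClicks T0 ρ i - T0 * μ i) - r) =
        prob μ ρ * Real.exp (s * explClicks T0 ρ i) * Real.exp (-(s * (T0 * μ i)) - r) := by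
    intro ρ
    rw [mul_assoc, ← Real.exp_add]
    ring_nf
  simp_rw [e]
  rw [← sum_mul, sum_prob_mul_exp_explClicks h]
  have hm := bernoulli_mgf_le (hμ i).1 (hμ i).2 hs
  have h0 : 0 ≤ μ i * Real.exp s + (1 - μ i) :=
    add_nonneg (mul_nonneg (hμ i).1 (Real.exp_pos s).le) (sub_nonneg.2 (hμ i).2)
  calc _ ≤ Real.exp (μ i * s + s ^ 2) ^ T0 * Real.exp (-(s * (T0 * μ i)) - r) := by gcongr
    _ = _ := by
      rw [← Real.exp_nat_mul, ← Real.exp_add]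
      ring_nf

end Concentration

section Regret

lemma regret_eq (A : Alloc k T) (μ v : Fin k → ℝ) :
    regret A μ v = ∑ ρ : Realization k T, prob μ ρ *
      ∑ t : Fin T, ((⨆ i, μ i * v i) - μ (A v ρ t) * v (A v ρ t)) := by
  simp_rw [sum_sub_distrib, mul_sub]
  rw [sum_sub_distrib, ← sum_mul, sum_prob]
  simp [regret]

lemma regret_le_of_forall (A : Alloc k T) {μ : Fin k → ℝ} (v : Fin k → ℝ) (hμ : ValidCTR μ)
    {F : Realization k T → ℝ}
    (hF : ∀ ρ, ∑ t : Fin T, ((⨆ i, μ i * v i) - μ (A v ρ t) * v (A v ρ t)) ≤ F ρ) :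
    regret A μ v ≤ ∑ ρ, prob μ ρ * F ρ := by
  rw [regret_eq]
  exact sum_le_sum fun ρ _ => mul_le_mul_of_nonneg_left (hF ρ) (prob_nonneg hμ ρ)

lemma round_regret_le {μ v : Fin k → ℝ} {vmax : ℝ} (hmax : 0 < vmax) (hμ : ValidCTR μ)
    (hv : ValidValues vmax v) (a : Fin k) : (⨆ i, μ i * v i) - μ a * v a ≤ vmax := by
  have h1 : (⨆ i, μ i * v i) ≤ vmax := Real.iSup_le (fun i => by
    nlinarith [hμ i, hv i, mul_le_mul_of_nonneg_right (hμ i).2 (hv i).1.le]) hmax.le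
  have h2 := mul_nonneg (hμ a).1 (hv a).1.le
  linarith

lemma regret_le_horizon (A : Alloc k T) {μ v : Fin k → ℝ} {vmax : ℝ} (hmax : 0 < vmax)
    (hμ : ValidCTR μ) (hv : ValidValues vmax v) : regret A μ v ≤ vmax * T := by
  refine (regret_le_of_forall A v hμ (F := fun _ => vmax * T) fun ρ => ?_).trans_eq ?_
  · refine (sum_le_sum fun t _ => round_regret_le hmax hμ hv (A v ρ t)).trans_eq ?_
    simp [mul_comm]
  · rw [← sum_mul, sum_prob, one_mul]

/-- An exponential upper bound for the indicator that the empirical CTR of agent `i` deviates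
from `μ i` by more than `2 * s`. -/
noncomputable def deviationBound (T0 : ℕ) (μ : Fin k → ℝ) (s : ℝ) (ρ : Realization k T)
    (i : Fin k) : ℝ :=
  Real.exp (s * (explClicks T0 ρ i - T0 * μ i) - 2 * s ^ 2 * T0) +
    Real.exp (-s * (explClicks T0 ρ i - T0 * μ i) - 2 * s ^ 2 * T0)

variable [NeZero k]

/-- Either the winner is nearly optimal, or some empirical CTR deviates. -/
lemma winner_regret_le {T0 : ℕ} (hT0 : 0 < T0) {μ v : Fin k → ℝ} {vmax : ℝ}
    (hmax : 0 < vmax) (hμ : ValidCTR μ) (hv : ValidValues vmax v) {s : ℝ} (hs : 0 < s)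
    (ρ : Realization k T) :
    (⨆ i, μ i * v i) - μ (naiveWinner T0 v ρ) * v (naiveWinner T0 v ρ) ≤
      vmax * (4 * s + ∑ i, deviationBound T0 μ s ρ i) := by
  have hpos : ∀ i, 0 ≤ deviationBound T0 μ s ρ i := fun i => by unfold deviationBound; positivity
  have hT : (0 : ℝ) < T0 := Nat.cast_pos.2 hT0
  by_cases hgood : ∀ i, |(explClicks T0 ρ i : ℝ) - T0 * μ i| ≤ 2 * s * T0
  · obtain ⟨j, hj⟩ := exists_eq_ciSup_of_finite (f := fun i => μ i * v i)
    rw [← hj]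
    have hw := score_le_naiveWinner T0 v ρ j
    set w := naiveWinner T0 v ρ
    have h1 := (abs_le.1 (hgood j)).1
    have h2 := (abs_le.1 (hgood w)).2
    have h3 := mul_le_mul_of_nonneg_right h1 (hv j).1.le
    have h4 := mul_le_mul_of_nonneg_right h2 (hv w).1.le
    have h5 : 2 * s * T0 * v j ≤ 2 * s * T0 * vmax :=
      mul_le_mul_of_nonneg_left (hv j).2 (by positivity)
    have h6 : 2 * s * T0 * v w ≤ 2 * s * T0 * vmax :=
      mul_le_mul_of_nonneg_left (hv w).2 (by positivity)
    have h7 : T0 * (μ j * v j - μ w * v w) ≤ T0 * (vmax * (4 * s)) := by linarith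
    refine (le_of_mul_le_mul_left h7 hT).trans ?_
    refine mul_le_mul_of_nonneg_left ?_ hmax.le
    linarith [sum_nonneg fun i (_ : i ∈ univ) => hpos i]
  · push Not at hgood
    obtain ⟨i, hi⟩ := hgood
    have h1 : 1 ≤ deviationBound T0 μ s ρ i := by
      unfold deviationBound
      rcases lt_abs.1 hi with h | h
      · have := Real.one_le_exp (x := s * (explClicks T0 ρ i - T0 * μ i) - 2 * s ^ 2 * T0)
          (by nlinarith [mul_lt_mul_of_pos_left h hs])
        have := Real.exp_pos (-s * (explClicks T0 ρ i - T0 * μ i) - 2 * s ^ 2 * T0)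
        linarith
      · have := Real.one_le_exp (x := -s * (explClicks T0 ρ i - T0 * μ i) - 2 * s ^ 2 * T0)
          (by nlinarith [mul_lt_mul_of_pos_left h hs])
        have := Real.exp_pos (s * (explClicks T0 ρ i - T0 * μ i) - 2 * s ^ 2 * T0)
        linarith
    have h2 := single_le_sum (f := deviationBound T0 μ s ρ) (fun i _ => hpos i) (mem_univ i)
    refine (round_regret_le hmax hμ hv _).trans (le_mul_of_one_le_right hmax.le ?_)
    linarith

lemma naive_regret_le {T0 : ℕ} (hT0 : 0 < T0) (h : k * T0 ≤ T) {μ v : Fin k → ℝ} {vmax : ℝ}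
    (hmax : 0 < vmax) (hμ : ValidCTR μ) (hv : ValidValues vmax v) {s : ℝ} (hs : 0 < s)
    (hs1 : s ≤ 1) :
    regret (naiveAlloc (T := T) T0) μ v ≤
      vmax * (k * T0 + T * (4 * s + 2 * k * Real.exp (-(s ^ 2 * T0)))) := by
  have hcard : (univ.filter fun t : Fin T => t.val < k * T0).card ≤ k * T0 := by
    rw [Fin.card_filter_val_lt]
    exact min_le_right _ _
  refine (regret_le_of_forall (naiveAlloc T0) v hμ
    (F := fun ρ => vmax * (k * T0 + T * (4 * s + ∑ i, deviationBound T0 μ s ρ i)))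
    fun ρ => ?_).trans ?_
  · have hdev : 0 ≤ 4 * s + ∑ i, deviationBound T0 μ s ρ i :=
      add_nonneg (by positivity) (sum_nonneg fun i _ => by unfold deviationBound; positivity)
    calc _ ≤ ∑ t : Fin T, ((if t.val < k * T0 then vmax else 0) +
          vmax * (4 * s + ∑ i, deviationBound T0 μ s ρ i)) := by
          refine sum_le_sum fun t _ => ?_
          split_ifs with ht
          · have := round_regret_le hmax hμ hv (naiveAlloc T0 v ρ t)
            have := mul_nonneg hmax.le hdev
            linarith
          · rw [naiveAlloc_of_le T0 v ρ (not_lt.1 ht), zero_add]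
            exact winner_regret_le hT0 hmax hμ hv hs ρ
      _ = (univ.filter fun t : Fin T => t.val < k * T0).card * vmax +
          T * (vmax * (4 * s + ∑ i, deviationBound T0 μ s ρ i)) := by
          rw [sum_add_distrib, ← sum_filter]
          simp
      _ ≤ ((k * T0 : ℕ) : ℝ) * vmax +
          T * (vmax * (4 * s + ∑ i, deviationBound T0 μ s ρ i)) := by gcongr
      _ = _ := by push_cast; ring
  · have hE : ∀ i, ∑ ρ : Realization k T, prob μ ρ * deviationBound T0 μ s ρ i ≤
        2 * Real.exp (-(s ^ 2 * T0)) := by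
      intro i
      have habs : |s| ≤ 1 := by rwa [abs_of_pos hs]
      have h1 := sum_prob_mul_exp_deviation_le h hμ i habs (2 * s ^ 2 * T0)
      have h2 := sum_prob_mul_exp_deviation_le h hμ i (s := -s) (by rwa [abs_neg])
        (2 * s ^ 2 * T0)
      have e1 : T0 * s ^ 2 - 2 * s ^ 2 * T0 = -(s ^ 2 * T0) := by ring
      have e2 : T0 * (-s) ^ 2 - 2 * s ^ 2 * T0 = -(s ^ 2 * T0) := by ring
      rw [e1] at h1
      rw [e2] at h2
      simp only [deviationBound, mul_add, sum_add_distrib]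
      linarith
    have hsum : ∑ ρ : Realization k T, prob μ ρ * ∑ i, deviationBound T0 μ s ρ i ≤
        2 * k * Real.exp (-(s ^ 2 * T0)) := by
      simp_rw [mul_sum]
      rw [sum_comm]
      refine (sum_le_sum fun i _ => hE i).trans_eq ?_
      simp
      ring
    have e : ∀ ρ : Realization k T,
        prob μ ρ * (vmax * (k * T0 + T * (4 * s + ∑ i, deviationBound T0 μ s ρ i))) =
          prob μ ρ * (vmax * (k * T0 + T * (4 * s))) +
            vmax * T * (prob μ ρ * ∑ i, deviationBound T0 μ s ρ i) := by
      intro ρ; ring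
    simp_rw [e]
    rw [sum_add_distrib, ← sum_mul, sum_prob, ← mul_sum]
    have := mul_le_mul_of_nonneg_left hsum (mul_nonneg hmax.le (Nat.cast_nonneg T))
    linarith

lemma naive_regret_rate (hT : 2 ≤ T) {μ v : Fin k → ℝ} {vmax : ℝ} (hmax : 0 < vmax)
    (hμ : ValidCTR μ) (hv : ValidValues vmax v) :
    regret (naiveAlloc (T := T) (naiveT0 k T)) μ v ≤
      30 * vmax * (k : ℝ) ^ ((1 : ℝ) / 3) * (T : ℝ) ^ ((2 : ℝ) / 3) *
        (Real.log T) ^ ((2 : ℝ) / 3) := by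
  have hk1 : (1 : ℝ) ≤ k := by exact_mod_cast NeZero.one_le
  have hT2 : (2 : ℝ) ≤ T := by exact_mod_cast hT
  have hL : 1 / 2 ≤ Real.log T :=
    (by linarith [Real.log_two_gt_d9] : (1 : ℝ) / 2 ≤ Real.log 2).trans
      (Real.log_le_log two_pos hT2)
  have cube : ∀ x : ℝ, 0 ≤ x → (x ^ ((1 : ℝ) / 3)) ^ 3 = x := fun x hx => by
    rw [← Real.rpow_natCast, ← Real.rpow_mul hx]; norm_num
  have square : ∀ x : ℝ, 0 ≤ x → x ^ ((2 : ℝ) / 3) = (x ^ ((1 : ℝ) / 3)) ^ 2 := fun x hx => by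
    rw [← Real.rpow_natCast, ← Real.rpow_mul hx]; norm_num
  have hL0 : 0 ≤ Real.log T := by linarith
  have hT0def : naiveT0 k T = ⌈((T : ℝ) ^ ((1 : ℝ) / 3)) ^ 2 * (Real.log T) ^ ((1 : ℝ) / 3) /
      ((k : ℝ) ^ ((1 : ℝ) / 3)) ^ 2⌉₊ := by
    rw [naiveT0, square T (by positivity), square k (by positivity)]
  rw [square T (by positivity), square _ hL0]
  have ha3 := cube k (by positivity)
  have ht3 := cube T (by positivity)
  have hl3 := cube _ hL0
  have ha1 : 1 ≤ (k : ℝ) ^ ((1 : ℝ) / 3) := Real.one_le_rpow hk1 (by norm_num)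
  have ht1 : 1 ≤ (T : ℝ) ^ ((1 : ℝ) / 3) := Real.one_le_rpow (by linarith) (by norm_num)
  have hl0 : 0 ≤ (Real.log T) ^ ((1 : ℝ) / 3) := Real.rpow_nonneg hL0 _
  generalize (k : ℝ) ^ ((1 : ℝ) / 3) = a at *
  generalize (T : ℝ) ^ ((1 : ℝ) / 3) = t at *
  generalize (Real.log T) ^ ((1 : ℝ) / 3) = l at *
  have hl : 1 / 2 ≤ l := by
    by_contra! hlt
    have : l ^ 3 ≤ (1 / 2) ^ 3 := pow_le_pow_left₀ hl0 hlt.le 3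
    norm_num at this
    linarith
  have ha0 : 0 < a := by linarith
  have ht0 : 0 < t := by linarith
  have hX1 : a * t ^ 2 ≤ 4 * (a * t ^ 2 * l ^ 2) := by
    have : 1 ≤ 4 * l ^ 2 := by nlinarith
    nlinarith [mul_le_mul_of_nonneg_left this (by positivity : 0 ≤ a * t ^ 2)]
  have hXl : a * t ^ 2 * l ≤ 2 * (a * t ^ 2 * l ^ 2) := by
    have : l ≤ 2 * l ^ 2 := by nlinarith
    nlinarith [mul_le_mul_of_nonneg_left this (by positivity : 0 ≤ a * t ^ 2)]
  have h1 : 1 ≤ a * t ^ 2 := by nlinarith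
  suffices h : ∃ B, regret (naiveAlloc (T := T) (naiveT0 k T)) μ v ≤ vmax * B ∧
      B ≤ 30 * (a * t ^ 2 * l ^ 2) by
    obtain ⟨B, hB, hB'⟩ := h
    have := mul_le_mul_of_nonneg_left hB' hmax.le
    linarith
  have htriv := regret_le_horizon (naiveAlloc (T := T) (naiveT0 k T)) hmax hμ hv
  rcases lt_or_ge (T : ℝ) k with hTk | hkT
  · refine ⟨T, htriv, ?_⟩
    have hta : t ≤ a := le_of_not_gt fun h =>
      absurd (pow_lt_pow_left₀ h ha0.le three_ne_zero) (by linarith)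
    nlinarith [mul_le_mul_of_nonneg_right hta (sq_nonneg t)]
  have hat : a ≤ t := le_of_not_gt fun h =>
    absurd (pow_lt_pow_left₀ h ht0.le three_ne_zero) (by linarith)
  have hlow : t ^ 2 * l / a ^ 2 ≤ naiveT0 k T := hT0def ▸ Nat.le_ceil _
  have hup : (naiveT0 k T : ℝ) ≤ t ^ 2 * l / a ^ 2 + 1 :=
    hT0def ▸ (Nat.ceil_lt_add_one (by positivity)).le
  have hpos : 0 < naiveT0 k T := by
    rw [hT0def]
    exact Nat.ceil_pos.2 (by positivity)
  generalize naiveT0 k T = T0 at *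
  have hkT0 : (k : ℝ) * T0 ≤ a * t ^ 2 * l + a * t ^ 2 := by
    have e : a ^ 3 * (t ^ 2 * l / a ^ 2 + 1) = a * t ^ 2 * l + a ^ 3 := by
      field_simp
    have h2 : a ^ 3 ≤ a * t ^ 2 := by
      have : a ^ 2 ≤ t ^ 2 := pow_le_pow_left₀ ha0.le hat 2
      nlinarith [mul_le_mul_of_nonneg_left this ha0.le]
    have := mul_le_mul_of_nonneg_left hup (by positivity : 0 ≤ a ^ 3)
    rw [← ha3]
    linarith
  rcases lt_or_ge T (k * T0) with hlong | hshort
  · refine ⟨T, htriv, ?_⟩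
    have : (T : ℝ) ≤ k * T0 := by exact_mod_cast hlong.le
    linarith
  have hsT : 3 / 2 * l * a / t * T = 3 / 2 * (a * t ^ 2 * l) := by
    rw [← ht3]; field_simp
  have hs0 : 0 < 3 / 2 * l * a / t := by positivity
  rcases lt_or_ge 1 (3 / 2 * l * a / t) with hbig | hsmall
  · refine ⟨T, htriv, ?_⟩
    have : 1 * (T : ℝ) ≤ 3 / 2 * l * a / t * T := by gcongr
    linarith
  refine ⟨_, naive_regret_le hpos hshort hmax hμ hv hs0 hsmall, ?_⟩
  have hexp : Real.exp (-((3 / 2 * l * a / t) ^ 2 * T0)) ≤ 1 / (T : ℝ) ^ 2 := by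
    have h2 : 2 * Real.log T ≤ (3 / 2 * l * a / t) ^ 2 * T0 := by
      have e : (3 / 2 * l * a / t) ^ 2 * (t ^ 2 * l / a ^ 2) = 9 / 4 * l ^ 3 := by
        field_simp; ring
      have := mul_le_mul_of_nonneg_left hlow (sq_nonneg (3 / 2 * l * a / t))
      linarith
    refine (Real.exp_le_exp.2 (neg_le_neg h2)).trans_eq ?_
    rw [Real.exp_neg, two_mul, Real.exp_add, Real.exp_log (by linarith), one_div, sq]
  have htail : T * (2 * k * Real.exp (-((3 / 2 * l * a / t) ^ 2 * T0))) ≤ 2 := by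
    calc _ ≤ (T : ℝ) * (2 * T * (1 / (T : ℝ) ^ 2)) := by gcongr
      _ = 2 := by field_simp
  linarith

end Regret

/-- The naive MAB mechanism (round-robin exploration of `T₀` rounds per
agent, then playing an agent maximizing `c_i b_i` forever, with the second-price-style
payment) is normalized, truthful, and has worst-case regret
`O(vmax · k^{1/3} · T^{2/3} · (log T)^{2/3})`. -/
theorem naive_mechanism :
    ∃ C : ℝ, 0 < C ∧ ∀ k T : ℕ, 2 ≤ k → 2 ≤ T →
      ∃ (A : Alloc k T) (P : Payment k T),
        Online A ∧
        -- exploration phase: round-robin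
        (∀ (b : Fin k → ℝ) (ρ : Realization k T) (t : Fin T), PosBids b →
          t.val < k * naiveT0 k T → (A b ρ t).val = t.val % k) ∧
        -- exploitation phase and payments
        (∀ (b : Fin k → ℝ) (ρ : Realization k T), PosBids b →
          ∃ istar : Fin k,
            (∀ j : Fin k, (explClicks (naiveT0 k T) ρ j : ℝ) * b j ≤
              (explClicks (naiveT0 k T) ρ istar : ℝ) * b istar) ∧
            (∀ t : Fin T, k * naiveT0 k T ≤ t.val → A b ρ t = istar) ∧
            P b ρ istar =
              ((⨆ j : {j : Fin k // j ≠ istar}, (explClicks (naiveT0 k T) ρ j.1 : ℝ) * b j.1) /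
                  (explClicks (naiveT0 k T) ρ istar : ℝ)) *
                (exploitClicks A (naiveT0 k T) b ρ istar : ℝ) ∧
            (∀ j : Fin k, j ≠ istar → P b ρ j = 0)) ∧
        PaymentObservable A P ∧ Normalized A P ∧ Truthful A P ∧
        ∀ vmax : ℝ, 0 < vmax →
          worstRegret A vmax ≤
            C * vmax * (k : ℝ) ^ ((1 : ℝ) / 3) * (T : ℝ) ^ ((2 : ℝ) / 3) *
              (Real.log T) ^ ((2 : ℝ) / 3) := by
  refine ⟨30, by norm_num, fun k T hk hT => ?_⟩
  have : NeZero k := ⟨by omega⟩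
  refine ⟨naiveAlloc (naiveT0 k T), naivePayment (naiveT0 k T), naiveAlloc_online _, ?_, ?_,
    naivePayment_observable _, naivePayment_normalized _, naive_truthful _, ?_⟩
  · intro b ρ t _ ht
    rw [naiveAlloc_of_lt _ b ρ ht]
    rfl
  · intro b ρ _
    refine ⟨naiveWinner (naiveT0 k T) b ρ, score_le_naiveWinner _ b ρ,
      fun t ht => naiveAlloc_of_le _ b ρ ht, ?_, fun j hj => if_neg hj⟩
    exact if_pos rfl
  · intro vmax hmax
    refine Real.sSup_le ?_ ?_
    · rintro r ⟨μ, v, hμ, hv, rfl⟩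
      exact naive_regret_rate hT hmax hμ hv
    · have := Real.log_nonneg (by exact_mod_cast (by omega : 1 ≤ T) : (1 : ℝ) ≤ T)
      positivity

end MAB
end

section
/- Let A be a deterministic allocation rule for the MAB mechanism design problem that is pointwise monotone, scale-free, and satisfies IIA. Let ρ be a realization, t a round, and i ≠ j two agents. Suppose α and β are bid profiles with A(α;ρ;t) ∈ {i,j}, A(β;ρ;t) ∈ {i,j}, and α_i/α_j = β_i/β_j. Then A(α;ρ;t) = A(β;ρ;t). -/
open Finset

namespace MAB

variable {k T : ℕ}

/-- A chosen agent keeps the impression when the bids of other agents decrease. -/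
theorem PointwiseMonotone.eq_of_le {A : Alloc k T} (hPM : PointwiseMonotone A) (hIIA : IIA A)
    {ρ : Realization k T} {t : Fin T} {b b' : Fin k → ℝ} {m : Fin k} (hb : PosBids b)
    (hle : b ≤ b') (hm : b m = b' m) (h : A b' ρ t = m) : A b ρ t = m := by
  have hb' : PosBids b' := fun l => (hb l).trans_le (hle l)
  have key : ∀ S : Finset (Fin k), A (S.piecewise b b') ρ t = m := by
    intro S
    induction S using Finset.induction_on with
    | empty => simpa using h
    | insert l S hl ih =>
      rw [Finset.piecewise_insert]
      have hc : PosBids (S.piecewise b b') := fun n => by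
        by_cases hn : n ∈ S <;> simp [hn, hb n, hb' n]
      have hcl : S.piecewise b b' l = b' l := Finset.piecewise_eq_of_notMem _ _ _ hl
      rcases (hle l).eq_or_lt with heq | hlt
      · rwa [heq, ← hcl, Function.update_eq_self]
      · have hml : m ≠ l := by
          rintro rfl
          exact hlt.ne hm
        by_contra hne
        rcases hIIA _ ρ t l (b l) hc (hb l) (by rw [ih]; exact Ne.symm hne) with h1 | h1
        · exact hml (ih.symm.trans h1)
        · have hpos : PosBids (Function.update (S.piecewise b b') l (b l)) := fun n => by
            by_cases hn : n = l
            · subst hn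
              simpa using hb n
            · simpa [hn] using hc n
          have h2 := hPM _ ρ t l (b' l) hpos h1 (by simpa using hlt)
          rw [Function.update_idem, ← hcl, Function.update_eq_self] at h2
          exact hml (ih.symm.trans h2)
  simpa using key Finset.univ

/-- For a pointwise monotone, scale-free, IIA allocation rule,
if the mechanism chooses between agents `i` and `j` then the choice depends only on
the ratio of their bids. -/
theorem equal_ratio_same_allocation (k T : ℕ) (A : Alloc k T)
    (hOnline : Online A) (hPM : PointwiseMonotone A) (hSF : ScaleFree A) (hIIA : IIA A)
    (ρ : Realization k T) (t : Fin T) (i j : Fin k) (hij : i ≠ j)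
    (α β : Fin k → ℝ) (hα : PosBids α) (hβ : PosBids β)
    (hαt : A α ρ t = i ∨ A α ρ t = j) (hβt : A β ρ t = i ∨ A β ρ t = j)
    (hratio : α i / α j = β i / β j) :
    A α ρ t = A β ρ t := by
  have hc : 0 < α j / β j := div_pos (hα j) (hβ j)
  rw [← hSF _ β ρ t hc hβ] at hβt ⊢
  set γ : Fin k → ℝ := fun n => α j / β j * β n with hγdef
  have hγ : PosBids γ := fun n => mul_pos hc (hβ n)
  have hj : α j = γ j := (div_mul_cancel₀ _ (hβ j).ne').symm
  have hi : α i = γ i := by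
    rw [div_eq_div_iff (hα j).ne' (hβ j).ne'] at hratio
    simp only [hγdef]
    rw [div_mul_eq_mul_div, eq_div_iff (hβ j).ne', hratio, mul_comm]
  have hagree : ∀ m, m = i ∨ m = j → α m = γ m := by
    rintro m (rfl | rfl)
    exacts [hi, hj]
  have hmin : PosBids (α ⊓ γ) := fun n => lt_min (hα n) (hγ n)
  have h1 : A (α ⊓ γ) ρ t = A α ρ t :=
    hPM.eq_of_le hIIA hmin inf_le_left (by simp [← hagree _ hαt]) rfl
  have h2 : A (α ⊓ γ) ρ t = A γ ρ t :=
    hPM.eq_of_le hIIA hmin inf_le_right (by simp [hagree _ hβt]) rfl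
  exact h1.symm.trans h2

end MAB
end

section
/- Let A be a deterministic allocation rule for the MAB mechanism design problem that is pointwise monotone, scale-free, and satisfies IIA. Let ρ be a realization and t a round. If there exist bid profiles α and β with A(α;ρ;t) = i and A(β;ρ;t) = j ≠ i, then there exists a bid β_i⁺ > β_i such that A(β_i⁺, β_{-i};ρ;t) = i. (If agent i can get the impression in round t at all, then starting from any bid profile she can get it by raising her bid high enough.) -/
open Finset

namespace MAB

variable {k T : ℕ}

/-- Under pointwise monotonicity and IIA, lowering the bids of a set of agents other than the
chosen one does not change the choice. -/
lemma alloc_piecewise_eq_of_lt {A : Alloc k T} (hPM : PointwiseMonotone A) (hIIA : IIA A)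
    {ρ : Realization k T} {t : Fin T} {i : Fin k} {b γ : Fin k → ℝ}
    (hb : PosBids b) (hγ : PosBids γ) (hlt : ∀ m, b m < γ m) (hγt : A γ ρ t = i)
    (s : Finset (Fin k)) (hs : i ∉ s) : A (s.piecewise b γ) ρ t = i := by
  induction s using Finset.induction_on with
  | empty => simpa using hγt
  | insert m s hm ih =>
    rw [Finset.mem_insert, not_or] at hs
    have hi := ih hs.2
    have hpos : ∀ s' : Finset (Fin k), PosBids (s'.piecewise b γ) := fun s' n => by
      by_cases h : n ∈ s' <;> simp [h, hb n, hγ n]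
    by_contra hne
    have hsm : (insert m s).piecewise b γ = Function.update (s.piecewise b γ) m (b m) :=
      Finset.piecewise_insert s b γ m
    have hm_win : A ((insert m s).piecewise b γ) ρ t = m := by
      have h := hIIA (s.piecewise b γ) ρ t m (b m) (hpos s) (hb m)
      rw [← hsm, hi] at h
      exact (h (Ne.symm hne)).resolve_left hs.1
    have hraise := hPM _ ρ t m (γ m) (hpos (insert m s)) hm_win (by simpa using hlt m)
    have hback : Function.update ((insert m s).piecewise b γ) m (γ m) = s.piecewise b γ := by
      rw [hsm, Function.update_idem, Function.update_eq_self_iff]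
      simp [hm]
    rw [hback, hi] at hraise
    exact hs.1 hraise

/-- For a pointwise monotone, scale-free, IIA allocation rule:
if agent `i` can get the impression at round `t` at all, then starting from any bid
profile she can get it by raising her bid high enough. -/
theorem can_raise_bid_to_win (k T : ℕ) (A : Alloc k T)
    (hOnline : Online A) (hPM : PointwiseMonotone A) (hSF : ScaleFree A) (hIIA : IIA A)
    (ρ : Realization k T) (t : Fin T) (i j : Fin k) (hij : j ≠ i)
    (α β : Fin k → ℝ) (hα : PosBids α) (hβ : PosBids β)
    (hαt : A α ρ t = i) (hβt : A β ρ t = j) :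
    ∃ x : ℝ, β i < x ∧ A (Function.update β i x) ρ t = i := by
  obtain ⟨c, hc, hlt⟩ : ∃ c : ℝ, 0 < c ∧ ∀ m, β m < c * α m := by
    have hnn : ∀ m, 0 ≤ β m / α m := fun m => (div_pos (hβ m) (hα m)).le
    have hsum : 0 ≤ ∑ m, β m / α m := Finset.sum_nonneg fun m _ => hnn m
    refine ⟨1 + ∑ m, β m / α m, by linarith, fun m => ?_⟩
    rw [← div_lt_iff₀ (hα m)]
    linarith [Finset.single_le_sum (fun m _ => hnn m) (Finset.mem_univ m)]
  refine ⟨c * α i, hlt i, ?_⟩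
  have h := alloc_piecewise_eq_of_lt hPM hIIA hβ (fun m => mul_pos hc (hα m)) hlt
    ((hSF c α ρ t hc hα).trans hαt) (univ.erase i) (Finset.notMem_erase i univ)
  convert h using 2
  ext m
  by_cases hm : m = i
  · subst hm; simp
  · simp [hm]

end MAB
end

section
/- Let A be a deterministic allocation rule for the MAB mechanism design problem that is pointwise monotone, scale-free, and satisfies IIA. Fix a realization ρ, a round t, and two distinct agents i and j, and let b_{-i-j} be bids for all agents other than i and j such that there exist positive bids x_0 (for i) and y (for j) with A(x_0, y, b_{-i-j};ρ;t) = j, and there exists x with A(x, y, b_{-i-j};ρ;t) = i. Fixing such a y, define the threshold Θ^{b_{-i-j}}_{i,j}(ρ,t) = (1/y) · inf{ x : A(x, y, b_{-i-j};ρ;t) = i }. Then for any other bids b'_{-i-j} of the agents other than i and j, the same existence conditions hold and Θ^{b'_{-i-j}}_{i,j}(ρ,t) = Θ^{b_{-i-j}}_{i,j}(ρ,t); that is, the threshold is independent of the bids of the agents other than i and j. -/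
open Finset

namespace MAB

variable {k T : ℕ}

/-- The bid profile obtained from `b` by giving agent `i` bid `x` and agent `j` bid `y`. -/
noncomputable def twoBid (b : Fin k → ℝ) (i j : Fin k) (x y : ℝ) : Fin k → ℝ :=
  Function.update (Function.update b i x) j y

theorem posBids_twoBid {b : Fin k → ℝ} (hb : PosBids b) (i j : Fin k) {x y : ℝ}
    (hx : 0 < x) (hy : 0 < y) : PosBids (twoBid b i j x y) := by
  intro l
  have := hb l
  simp only [twoBid, Function.update_apply]
  split_ifs <;> assumption

/-- Lowering the bid of an agent who is not played does not change the allocation. -/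
theorem alloc_update_of_le {A : Alloc k T} (hPM : PointwiseMonotone A) (hIIA : IIA A)
    {ρ : Realization k T} {t : Fin T} {c : Fin k → ℝ} (hc : PosBids c) {l : Fin k}
    (hl : l ≠ A c ρ t) {x : ℝ} (hx : 0 < x) (hxc : x ≤ c l) :
    A (Function.update c l x) ρ t = A c ρ t := by
  by_contra hne
  have hnew : A (Function.update c l x) ρ t = l :=
    (hIIA c ρ t l x hc hx (Ne.symm hne)).resolve_left (Ne.symm hl)
  rcases hxc.eq_or_lt with rfl | hlt
  · simp at hne
  · have hpos : PosBids (Function.update c l x) := by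
      intro n
      have := hc n
      simp only [Function.update_apply]
      split_ifs <;> assumption
    have := hPM _ ρ t l (c l) hpos hnew (by simpa using hlt)
    simp only [Function.update_idem, Function.update_eq_self] at this
    exact hl this.symm

/-- Lowering the bids of agents who are not played does not change the allocation. -/
theorem alloc_eq_of_le {A : Alloc k T} (hPM : PointwiseMonotone A) (hIIA : IIA A)
    {ρ : Realization k T} {t : Fin T} {m c : Fin k → ℝ} {a : Fin k} (hm : PosBids m)
    (hc : PosBids c) (hmc : ∀ l, m l ≤ c l) (hA : A c ρ t = a) (ha : m a = c a) :
    A m ρ t = a := by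
  have key : ∀ s : Finset (Fin k), A (s.piecewise m c) ρ t = a := by
    intro s
    induction s using Finset.induction_on with
    | empty => simpa using hA
    | insert l s hls ih =>
      rw [Finset.piecewise_insert]
      by_cases hla : l = a
      · have : Function.update (s.piecewise m c) l (m l) = s.piecewise m c := by
          rw [Function.update_eq_self_iff, Finset.piecewise_eq_of_notMem _ _ _ hls, hla, ha]
        rwa [this]
      · have hpos : PosBids (s.piecewise m c) := by
          intro n
          by_cases hn : n ∈ s
          · simpa [hn] using hm n
          · simpa [hn] using hc n
        rw [alloc_update_of_le hPM hIIA hpos (by rwa [ih]) (hm l) (by simpa [hls] using hmc l), ih]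
  simpa using key univ

/-- If agent `j` is played for some bid of agent `i`, then any bid ratio at which `i` is played
against `j` under other bids of the remaining agents also makes `i` played under these bids. -/
theorem alloc_twoBid_transfer {A : Alloc k T} (hPM : PointwiseMonotone A) (hSF : ScaleFree A)
    (hIIA : IIA A) {ρ : Realization k T} {t : Fin T} {i j : Fin k} (hij : i ≠ j)
    {b b' : Fin k → ℝ} (hb : PosBids b) (hb' : PosBids b') {x x' y y' : ℝ} (hy : 0 < y)
    (hy' : 0 < y') (hx' : 0 < x') (hx : x = y / y' * x')
    (hj : ∃ x0 : ℝ, 0 < x0 ∧ A (twoBid b i j x0 y) ρ t = j)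
    (hi : A (twoBid b' i j x' y') ρ t = i) :
    A (twoBid b i j x y) ρ t = i := by
  obtain ⟨x0, hx0, hj⟩ := hj
  have hd : 0 < y / y' := div_pos hy hy'
  have hxpos : 0 < x := hx ▸ mul_pos hd hx'
  have hp := posBids_twoBid hb i j hxpos hy
  have hp' := posBids_twoBid hb' i j hx' hy'
  have hsc := hSF (y / y') _ ρ t hd hp'
  rw [hi] at hsc
  have hps : PosBids (fun l => y / y' * twoBid b' i j x' y' l) := fun l => mul_pos hd (hp' l)
  let m : Fin k → ℝ := fun l => min (y / y' * twoBid b' i j x' y' l) (twoBid b i j x y l)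
  have hm : PosBids m := fun l => lt_min (hps l) (hp l)
  have hmi : A m ρ t = i :=
    alloc_eq_of_le hPM hIIA hm hps (fun l => min_le_left _ _) hsc (by simp [m, twoBid, hij, hx])
  by_contra hne
  have hupd : Function.update (twoBid b i j x0 y) i x = twoBid b i j x y := by
    simp [twoBid, Function.update_comm hij.symm]
  have hnj : A (twoBid b i j x y) ρ t = j := by
    by_contra hnj
    rcases hIIA _ ρ t i x (posBids_twoBid hb i j hx0 hy) hxpos
      (by rw [hupd, hj]; exact Ne.symm hnj) with h | h
    · exact hij (h.symm.trans hj)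
    · exact hne (hupd ▸ h)
  have hmj : A m ρ t = j :=
    alloc_eq_of_le hPM hIIA hm hp (fun l => min_le_right _ _) hnj
      (by simp [m, twoBid, div_mul_cancel₀ y hy'.ne'])
  exact hij (hmi.symm.trans hmj)

/-- For any other bids of the remaining agents, scaling up the bids of `i` and `j` by a common
factor preserves the fact that `i` or `j` is played. -/
theorem exists_scale_alloc_twoBid {A : Alloc k T} (hPM : PointwiseMonotone A) (hSF : ScaleFree A)
    (hIIA : IIA A) (ρ : Realization k T) (t : Fin T) (i j : Fin k)
    {b b' : Fin k → ℝ} (hb : PosBids b) (hb' : PosBids b') :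
    ∃ c : ℝ, 0 < c ∧ ∀ x y : ℝ, 0 < x → 0 < y → ∀ a, a = i ∨ a = j →
      A (twoBid b i j x y) ρ t = a → A (twoBid b' i j (c * x) (c * y)) ρ t = a := by
  have hnn : ∀ l ∈ (univ : Finset (Fin k)), 0 ≤ b' l / b l :=
    fun l _ => (div_pos (hb' l) (hb l)).le
  have hc : 0 < 1 + ∑ l, b' l / b l := by
    have := Finset.sum_nonneg hnn
    linarith
  refine ⟨_, hc, fun x y hx hy a ha hA => ?_⟩
  have hle : ∀ l, b' l ≤ (1 + ∑ l, b' l / b l) * b l := by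
    intro l
    rw [← div_le_iff₀ (hb l)]
    have := Finset.single_le_sum hnn (mem_univ l)
    linarith
  generalize 1 + ∑ l, b' l / b l = c at hc hle ⊢
  have hp := posBids_twoBid hb i j hx hy
  refine alloc_eq_of_le hPM hIIA (posBids_twoBid hb' i j (mul_pos hc hx) (mul_pos hc hy))
    (c := fun l => c * twoBid b i j x y l) (fun l => mul_pos hc (hp l)) ?_
    ((hSF c _ ρ t hc hp).trans hA) ?_
  · intro l
    have := hle l
    simp only [twoBid, Function.update_apply]
    split_ifs <;> first | exact le_rfl | assumption
  · simp only [twoBid, Function.update_apply]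
    grind

/-- The threshold `Θ_{i,j}(ρ,t)` at which agent `i` steals the
impression from agent `j` is well defined: it does not depend on the bids of the
agents other than `i` and `j`. -/
theorem threshold_well_defined (k T : ℕ) (A : Alloc k T)
    (hOnline : Online A) (hPM : PointwiseMonotone A) (hSF : ScaleFree A) (hIIA : IIA A)
    (ρ : Realization k T) (t : Fin T) (i j : Fin k) (hij : i ≠ j)
    (b b' : Fin k → ℝ) (hb : PosBids b) (hb' : PosBids b')
    (y : ℝ) (hy : 0 < y)
    (hx0 : ∃ x0 : ℝ, 0 < x0 ∧ A (twoBid b i j x0 y) ρ t = j)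
    (hx : ∃ x : ℝ, 0 < x ∧ A (twoBid b i j x y) ρ t = i) :
    (∃ y' : ℝ, 0 < y' ∧ (∃ x0 : ℝ, 0 < x0 ∧ A (twoBid b' i j x0 y') ρ t = j) ∧
        (∃ x : ℝ, 0 < x ∧ A (twoBid b' i j x y') ρ t = i)) ∧
      ∀ y' : ℝ, 0 < y' →
        (∃ x0 : ℝ, 0 < x0 ∧ A (twoBid b' i j x0 y') ρ t = j) →
        (∃ x : ℝ, 0 < x ∧ A (twoBid b' i j x y') ρ t = i) →
          (1 / y') * sInf {x : ℝ | 0 < x ∧ A (twoBid b' i j x y') ρ t = i} =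
            (1 / y) * sInf {x : ℝ | 0 < x ∧ A (twoBid b i j x y) ρ t = i} := by
  have hj := hx0
  obtain ⟨x0, hx0, hA0⟩ := hx0
  obtain ⟨x1, hx1, hA1⟩ := hx
  obtain ⟨c, hc, hscale⟩ := exists_scale_alloc_twoBid hPM hSF hIIA ρ t i j hb hb'
  refine ⟨⟨c * y, mul_pos hc hy,
    ⟨c * x0, mul_pos hc hx0, hscale x0 y hx0 hy j (Or.inr rfl) hA0⟩,
    ⟨c * x1, mul_pos hc hx1, hscale x1 y hx1 hy i (Or.inl rfl) hA1⟩⟩, ?_⟩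
  intro y' hy' hj' _
  open scoped Pointwise in
  have hset : {x : ℝ | 0 < x ∧ A (twoBid b' i j x y') ρ t = i} =
      (y' / y) • {x : ℝ | 0 < x ∧ A (twoBid b i j x y) ρ t = i} := by
    have hd : 0 < y' / y := div_pos hy' hy
    ext x
    rw [Set.mem_smul_set]
    constructor
    · rintro ⟨hx, hA⟩
      refine ⟨y / y' * x, ⟨mul_pos (div_pos hy hy') hx,
        alloc_twoBid_transfer hPM hSF hIIA hij hb hb' hy hy' hx rfl hj hA⟩, ?_⟩
      rw [smul_eq_mul]
      field_simp
    · rintro ⟨z, ⟨hz, hA⟩, rfl⟩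
      exact ⟨mul_pos hd hz,
        alloc_twoBid_transfer hPM hSF hIIA hij hb' hb hy' hy hz rfl hj' hA⟩
  rw [hset, Real.sInf_smul_of_nonneg (div_pos hy' hy).le, smul_eq_mul]
  field_simp

end MAB
end

section
/- Let A be a non-degenerate deterministic allocation rule for the MAB mechanism design problem which is scale-free, pointwise monotone, satisfies IIA, and is weakly separated. Then for each agent l and each vector b_{-l} of bids of the other agents there exists a finite set S_l(b_{-l}) ⊂ ℝ with the following property: whenever there exist a bid b_l, a realization ρ and a round t such that round t is (b_l, b_{-l}; ρ)-influential with influencing agent l and round t is not bid-independent w.r.t. ρ, it holds that b_l ∈ S_l(b_{-l}). -/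
open Finset

namespace MAB

variable {k T : ℕ}

/-- Raising only the bids of agents other than `q` cannot make `q` chosen. -/
theorem not_chosen_of_raise_others {A : Alloc k T} (hPM : PointwiseMonotone A) (hIIA : IIA A)
    {b b' : Fin k → ℝ} (hb : PosBids b) (hb' : PosBids b') (hle : ∀ j, b j ≤ b' j)
    {q : Fin k} (hq : b q = b' q) {ρ : Realization k T} {t : Fin T}
    (h : A b ρ t ≠ q) : A b' ρ t ≠ q := by
  have key : ∀ s : Finset (Fin k), A (s.piecewise b' b) ρ t ≠ q := by
    intro s
    induction s using Finset.induction_on with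
    | empty => simpa using h
    | insert j s hj ih =>
      rw [Finset.piecewise_insert]
      have hpos : PosBids (s.piecewise b' b) := fun i => by
        by_cases hi : i ∈ s <;> simp [hi, hb i, hb' i]
      have hval : s.piecewise b' b j = b j := by simp [hj]
      intro hA
      have hupd : b j < b' j := by
        refine lt_of_le_of_ne (hle j) fun he => ih ?_
        rwa [← he, ← hval, Function.update_eq_self] at hA
      have hjq : j ≠ q := by
        rintro rfl
        exact hupd.ne hq
      rcases hIIA _ ρ t j (b' j) hpos (hb' j) (by rw [hA]; exact ih) with h1 | h1
      · exact hjq ((hPM _ ρ t j (b' j) hpos h1 (by rwa [hval])).symm.trans hA)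
      · exact hjq (h1.symm.trans hA)
  simpa using key Finset.univ

/-- An agent stays chosen if, relative to her own bid, no other bid goes up. -/
theorem chosen_of_ratio_le {A : Alloc k T} (hSF : ScaleFree A) (hPM : PointwiseMonotone A)
    (hIIA : IIA A) {b b' : Fin k → ℝ} (hb : PosBids b) (hb' : PosBids b') {q : Fin k}
    (hle : ∀ j, b j * b' q ≤ b' j * b q) {ρ : Realization k T} {t : Fin T}
    (h : A b' ρ t = q) : A b ρ t = q := by
  by_contra hne
  have hc : 0 < b q / b' q := div_pos (hb q) (hb' q)
  refine not_chosen_of_raise_others (b' := fun j => b q / b' q * b' j) hPM hIIA hb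
    (fun j => mul_pos hc (hb' j)) (fun j => ?_) ?_ hne ?_
  · rw [div_mul_eq_mul_div, le_div_iff₀ (hb' q)]
    linarith [hle j]
  · have := (hb' q).ne'
    field_simp
  · rw [hSF _ _ _ _ hc hb', h]

theorem flip_flip (ρ : Realization k T) (i : Fin k) (t : Fin T) :
    flip (flip ρ i t) i t = ρ := by
  funext j s
  by_cases h : j = i ∧ s = t <;> simp [flip, h]

/-- Flipping a bit of round `t` does not affect the choice at round `t`. -/
theorem Online.flip_same {A : Alloc k T} (hA : Online A) (b : Fin k → ℝ)
    (ρ : Realization k T) (i : Fin k) (t : Fin T) : A b (flip ρ i t) t = A b ρ t :=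
  (hA b ρ _ t fun s hs => by simp [flip, hs.ne]).symm

/-- Flipping an unobserved bit does not affect the allocation. -/
theorem Online.flip_unobserved {A : Alloc k T} (hA : Online A) {b : Fin k → ℝ}
    {ρ : Realization k T} {i : Fin k} {t : Fin T} (h : A b ρ t ≠ i) (t' : Fin T) :
    A b (flip ρ i t) t' = A b ρ t' := by
  refine (hA b ρ _ t' fun s _ => ?_).symm
  by_cases hs : s = t
  · subst hs
    simp [flip, h]
  · simp [flip, hs]

theorem PosBids.update {b : Fin k → ℝ} (hb : PosBids b) (i : Fin k) {x : ℝ} (hx : 0 < x) :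
    PosBids (Function.update b i x) := fun j => by
  by_cases h : j = i
  · subst h; simpa
  · simpa [h] using hb j

theorem posBids_update_of_ne {b : Fin k → ℝ} {l : Fin k} (hb : ∀ j, j ≠ l → 0 < b j) {x : ℝ}
    (hx : 0 < x) : PosBids (Function.update b l x) := fun j => by
  by_cases h : j = l
  · subst h; simpa
  · simpa [h] using hb j h

/-- In a round that is not bid-independent, any agent loses the impression
by bidding low enough. -/
theorem exists_low_bid_not_chosen {A : Alloc k T} (hSF : ScaleFree A)
    (hPM : PointwiseMonotone A) (hIIA : IIA A) {l : Fin k} {b : Fin k → ℝ}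
    (hb : ∀ j, j ≠ l → 0 < b j) {ρ : Realization k T} {t : Fin T}
    (h : ¬ BidIndependent A ρ t) : ∃ y, 0 < y ∧ A (Function.update b l y) ρ t ≠ l := by
  obtain ⟨b', hb', hl⟩ : ∃ b', PosBids b' ∧ A b' ρ t ≠ l := by
    by_contra! hall
    exact h fun b₁ b₂ h₁ h₂ => (hall b₁ h₁).trans (hall b₂ h₂).symm
  have hev : ∀ᶠ y in nhdsWithin (0 : ℝ) (Set.Ioi 0), ∀ j, j ≠ l → b' j * y < b j * b' l := by
    refine Filter.eventually_all.2 fun j => ?_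
    by_cases hj : j = l
    · exact Filter.Eventually.of_forall fun y h => absurd hj h
    · have hcont : Filter.Tendsto (fun y : ℝ => b' j * y) (nhdsWithin 0 (Set.Ioi 0))
          (nhds (b' j * 0)) :=
        ((continuous_const.mul continuous_id).tendsto 0).mono_left nhdsWithin_le_nhds
      have := hcont.eventually_lt_const (u := b j * b' l)
        (by rw [mul_zero]; exact mul_pos (hb j hj) (hb' l))
      exact this.mono fun y hy _ => hy
  obtain ⟨y, hy, hy0⟩ := (hev.and self_mem_nhdsWithin).exists
  refine ⟨y, hy0, fun hA => hl ?_⟩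
  refine chosen_of_ratio_le hSF hPM hIIA hb' (posBids_update_of_ne hb hy0) (fun j => ?_) hA
  by_cases hj : j = l
  · subst hj
    simp [mul_comm]
  · simpa [hj] using (hy j hj).le

/-- For fixed rounds, realization and influenced agents `i` (without the flip) and `l` (with the
flip), at most one bid of `l` is compatible with `l` losing round `t` when bidding low. -/
theorem influencing_bid_not_lt {A : Alloc k T} (hOnline : Online A) (hSF : ScaleFree A)
    (hPM : PointwiseMonotone A) (hIIA : IIA A) (hWS : WeaklySeparated A)
    {l i : Fin k} (hil : i ≠ l) {b : Fin k → ℝ} (hb : ∀ j, j ≠ l → 0 < b j)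
    {ρ : Realization k T} {t t' : Fin T} (htt' : t < t') {x₁ x₂ y : ℝ}
    (hx₁ : 0 < x₁) (hlt : x₁ < x₂) (hy : 0 < y) (hyl : A (Function.update b l y) ρ t ≠ l)
    (h : ∀ x, x = x₁ ∨ x = x₂ → A (Function.update b l x) ρ t = l ∧
      A (Function.update b l x) ρ t' = i ∧ A (Function.update b l x) (flip ρ l t) t' = l) :
    False := by
  have hx₂ : 0 < x₂ := hx₁.trans hlt
  have hpos : ∀ x, x = x₁ ∨ x = x₂ → 0 < x := by
    rintro x (rfl | rfl) <;> assumption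
  obtain ⟨m, hm⟩ : ∃ m, A (Function.update b l y) ρ t = m := ⟨_, rfl⟩
  have hml : m ≠ l := hm ▸ hyl
  have hbm := hb m hml
  let P : ℝ → ℝ → Fin k → ℝ := fun x z => Function.update (Function.update b l x) m z
  have hPl : ∀ x z, P x z l = x := fun x z => by simp [P, hml.symm]
  have hPm : ∀ x z, P x z m = z := fun x z => by simp [P]
  have hPj : ∀ x z j, j ≠ l → j ≠ m → P x z j = b j := fun x z j h₁ h₂ => by simp [P, h₁, h₂]
  have hP0 : ∀ x, P x (b m) = Function.update b l x := fun x => by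
    funext j
    by_cases hj : j = m
    · subst hj; simp [P, hml]
    · simp [P, hj]
  have hPP : ∀ x z, 0 < x → 0 < z → PosBids (P x z) := fun x z hx hz =>
    (posBids_update_of_ne hb hx).update m hz
  -- A high enough bid of `m` wins round `t`.
  have hhigh : ∀ x z, 0 < x → b m ≤ z → x * b m ≤ y * z → A (P x z) ρ t = m := by
    intro x z hx hz hxz
    have hz0 := hbm.trans_le hz
    refine chosen_of_ratio_le hSF hPM hIIA (hPP x z hx hz0) (hPP y (b m) hy hbm) (fun j => ?_)
      (by rw [hP0, hm])
    simp only [hPm]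
    by_cases hjl : j = l
    · subst hjl; simpa only [hPl] using hxz
    by_cases hjm : j = m
    · subst hjm; simp only [hPm, mul_comm, le_refl]
    simp only [hPj _ _ j hjl hjm]
    exact mul_le_mul_of_nonneg_left hz (hb j hjl).le
  have hhigh_ex : ∀ x z, 0 < x → ∃ z', z < z' ∧ A (P x z') ρ t = m := by
    intro x z hx
    refine ⟨max (z + 1) (max (b m) (x * b m / y)), ?_, hhigh x _ hx (by simp) ?_⟩
    · exact (lt_add_one z).trans_le (le_max_left _ _)
    · rw [← div_le_iff₀' hy]
      simp
  -- Round `t` is secured from `m` as soon as `m` is influenced, which contradicts `hhigh_ex`.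
  have hnot_infl : ∀ x z, 0 < x → 0 < z → A (P x z) ρ t = l →
      ¬ InfluencedAgent A (P x z) ρ t m := by
    intro x z hx hz hl hinf
    obtain ⟨z', hz', hA⟩ := hhigh_ex x z hx
    have := hWS _ ρ t m (hPP x z hx hz) hinf z' (by rwa [hPm])
    rw [hl, show Function.update (P x z) m z' = P x z' by simp [P], hA] at this
    exact hml this
  have hmi : m ≠ i := by
    rintro rfl
    obtain ⟨h₁, h₂, h₃⟩ := h x₁ (Or.inl rfl)
    rw [← hP0] at h₁ h₂ h₃
    exact hnot_infl x₁ (b m) hx₁ hbm h₁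
      ⟨t', htt', by rw [h₁, h₂, h₃]; exact hil, Or.inl h₂.symm⟩
  -- Changing the bid of `m` can only move the impression to `m`.
  have hdich : ∀ x z φ s q, 0 < x → 0 < z → q ≠ m → A (P x (b m)) φ s = q →
      A (P x z) φ s = q ∨ A (P x z) φ s = m := by
    intro x z φ s q hx hz hqm hq
    by_contra! hne
    have hupd : Function.update (P x (b m)) m z = P x z := by simp [P]
    rcases hIIA (P x (b m)) φ s m z (hPP x _ hx hbm) hz
      (by rw [hupd, hq]; exact hne.1.symm) with h1 | h1
    · exact hqm (hq.symm.trans h1)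
    · exact hne.2 (by rwa [hupd] at h1)
  have hiff : ∀ x z, (x = x₁ ∨ x = x₂) → 0 < z →
      (A (P x z) ρ t' = m ↔ A (P x z) (flip ρ l t) t' = m) := by
    intro x z hx hz
    obtain ⟨h₁, -, -⟩ := h x hx
    have hx0 := hpos x hx
    rw [← hP0] at h₁
    rcases hdich x z ρ t l hx0 hz hml.symm h₁ with hl | hl
    · have hn := hnot_infl x z hx0 hz hl
      simp only [InfluencedAgent, hl] at hn
      push Not at hn
      constructor
      · intro hA
        by_contra hne
        exact (hn t' htt' (by rw [hA]; exact Ne.symm hne)).1 hA.symm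
      · intro hA
        by_contra hne
        exact (hn t' htt' (by rw [hA]; exact hne)).2 hA.symm
    · rw [hOnline.flip_unobserved (hl.trans_ne hml)]
  -- If `m` wins the influenced round, she still does after scaling her bid by `x₁ / x₂`.
  have hstep : ∀ z, 0 < z → A (P x₁ z) (flip ρ l t) t' = m →
      A (P x₁ (x₁ / x₂ * z)) (flip ρ l t) t' = m := by
    intro z hz hA
    have h₁ := (hiff x₁ z (Or.inl rfl) hz).2 hA
    obtain ⟨-, h₂i, -⟩ := h x₂ (Or.inr rfl)
    obtain ⟨-, -, h₁l⟩ := h x₁ (Or.inl rfl)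
    rw [← hP0] at h₂i h₁l
    have h₂ : A (P x₂ z) ρ t' = m := by
      refine (hdich x₂ z ρ t' i hx₂ hz hmi.symm h₂i).resolve_left fun hi => hmi ?_
      rw [← h₁]
      refine chosen_of_ratio_le hSF hPM hIIA (hPP _ _ hx₁ hz) (hPP _ _ hx₂ hz) (fun j => ?_) hi
      have hle : P x₁ z j ≤ P x₂ z j := by
        by_cases hjl : j = l
        · subst hjl; simpa only [hPl] using hlt.le
        by_cases hjm : j = m
        · subst hjm; simp only [hPm, le_refl]
        simp only [hPj _ _ j hjl hjm, le_refl]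
      rw [hPj _ _ i hil hmi.symm, hPj _ _ i hil hmi.symm]
      exact mul_le_mul_of_nonneg_right hle (hb i hil).le
    have h₃ := (hiff x₂ z (Or.inr rfl) hz).1 h₂
    have hrz : 0 < x₁ / x₂ * z := by positivity
    refine (hdich x₁ _ _ t' l hx₁ hrz hml.symm h₁l).resolve_left fun hl => hml ?_
    rw [← h₃]
    refine chosen_of_ratio_le hSF hPM hIIA (hPP _ _ hx₂ hz) (hPP _ _ hx₁ hrz) (fun j => ?_) hl
    simp only [hPl]
    by_cases hjl : j = l
    · subst hjl; simp only [hPl, mul_comm, le_refl]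
    by_cases hjm : j = m
    · subst hjm
      simp only [hPm]
      apply le_of_eq
      field_simp
    simp only [hPj _ _ j hjl hjm]
    exact mul_le_mul_of_nonneg_left hlt.le (hb j hjl).le
  obtain ⟨-, -, hl₁⟩ := h x₁ (Or.inl rfl)
  rw [← hP0] at hl₁
  obtain ⟨z, hbz, hz⟩ := hhigh_ex x₁ (b m) hx₁
  have hz0 := hbm.trans hbz
  have hstart : A (P x₁ z) (flip ρ l t) t' = m := by
    rcases hdich x₁ z _ t' l hx₁ hz0 hml.symm hl₁ with hl | hl
    · obtain ⟨-, hi, -⟩ := h x₁ (Or.inl rfl)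
      rw [← hP0] at hi
      rw [hOnline.flip_unobserved (hz.trans_ne hml)] at hl ⊢
      rcases hdich x₁ z _ t' i hx₁ hz0 hmi.symm hi with hi' | hi'
      · exact absurd (hi'.symm.trans hl) hil
      · exact hi'
    · exact hl
  have hr0 : 0 < x₁ / x₂ := div_pos hx₁ hx₂
  have hiter : ∀ n : ℕ, A (P x₁ ((x₁ / x₂) ^ n * z)) (flip ρ l t) t' = m := by
    intro n
    induction n with
    | zero => simpa using hstart
    | succ n ih =>
      have := hstep _ (by positivity) ih
      rwa [← mul_assoc, ← pow_succ'] at this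
  obtain ⟨n, hn⟩ := exists_pow_lt_of_lt_one (div_pos hbm hz0) ((div_lt_one hx₂).2 hlt)
  have hw0 : 0 < (x₁ / x₂) ^ n * z := by positivity
  have hw : (x₁ / x₂) ^ n * z < b m := (lt_div_iff₀ hz0).1 hn
  have := hPM _ _ t' m (b m) (hPP x₁ _ hx₁ hw0) (hiter n) (by rwa [hPm])
  rw [show Function.update (P x₁ ((x₁ / x₂) ^ n * z)) m (b m) = P x₁ (b m) by simp [P], hl₁]
    at this
  exact hml this.symm

/-- An agent other than `l` that is chosen keeps the impression when `l` lowers her bid. -/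
theorem chosen_of_lower_bid {A : Alloc k T} (hSF : ScaleFree A) (hPM : PointwiseMonotone A)
    (hIIA : IIA A) {l i : Fin k} (hil : i ≠ l) {b : Fin k → ℝ} (hb : ∀ j, j ≠ l → 0 < b j)
    {x y : ℝ} (hy : 0 < y) (hyx : y ≤ x) {ρ : Realization k T} {t : Fin T}
    (h : A (Function.update b l x) ρ t = i) : A (Function.update b l y) ρ t = i := by
  refine chosen_of_ratio_le hSF hPM hIIA (posBids_update_of_ne hb hy)
    (posBids_update_of_ne hb (hy.trans_le hyx)) (fun j => ?_) h
  rw [Function.update_of_ne hil, Function.update_of_ne hil]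
  refine mul_le_mul_of_nonneg_right ?_ (hb i hil).le
  by_cases hj : j = l
  · subst hj; simpa
  · simp [hj]

/-- For fixed rounds, realization and influenced agents, at most one bid of `l` makes `l`
the influencing agent of a round that is not bid-independent. -/
theorem influencing_bids_subsingleton {A : Alloc k T} (hOnline : Online A) (hSF : ScaleFree A)
    (hPM : PointwiseMonotone A) (hIIA : IIA A) (hWS : WeaklySeparated A)
    {l i i' : Fin k} (hii' : i ≠ i') {b : Fin k → ℝ} (hb : ∀ j, j ≠ l → 0 < b j)
    {ρ : Realization k T} {t t' : Fin T} (htt' : t < t') (hBI : ¬ BidIndependent A ρ t) :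
    {x : ℝ | 0 < x ∧ A (Function.update b l x) ρ t = l ∧ A (Function.update b l x) ρ t' = i ∧
      A (Function.update b l x) (flip ρ l t) t' = i'}.Subsingleton := by
  suffices hlt : ∀ x₁ x₂, x₁ < x₂ → 0 < x₁ → ¬ (∀ x, x = x₁ ∨ x = x₂ →
      A (Function.update b l x) ρ t = l ∧ A (Function.update b l x) ρ t' = i ∧
      A (Function.update b l x) (flip ρ l t) t' = i') by
    rintro x₁ ⟨h₁, h₁'⟩ x₂ ⟨h₂, h₂'⟩
    rcases lt_trichotomy x₁ x₂ with hx | hx | hx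
    · exact (hlt x₁ x₂ hx h₁ (by rintro x (rfl | rfl) <;> assumption)).elim
    · exact hx
    · exact (hlt x₂ x₁ hx h₂ (by rintro x (rfl | rfl) <;> assumption)).elim
  intro x₁ x₂ hlt hx₁ h
  obtain ⟨y, hy, hyl⟩ := exists_low_bid_not_chosen hSF hPM hIIA hb hBI
  by_cases hi : i = l
  · refine influencing_bid_not_lt hOnline hSF hPM hIIA hWS (hi ▸ hii'.symm) hb
      (ρ := flip ρ l t) htt' hx₁ hlt hy (by rwa [hOnline.flip_same]) fun x hx => ?_
    obtain ⟨h₁, h₂, h₃⟩ := h x hx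
    rw [hOnline.flip_same, flip_flip]
    exact ⟨h₁, h₃, h₂.trans hi⟩
  by_cases hi' : i' = l
  · exact influencing_bid_not_lt hOnline hSF hPM hIIA hWS hi hb htt' hx₁ hlt hy hyl (hi' ▸ h)
  obtain ⟨h₁, h₂, h₃⟩ := h x₁ (Or.inl rfl)
  have hmin : 0 < min x₁ y := lt_min hx₁ hy
  have hmin_l : A (Function.update b l (min x₁ y)) ρ t ≠ l := fun hc =>
    (chosen_of_lower_bid hSF hPM hIIA hyl hb hmin (min_le_right _ _) rfl).symm.trans hc |> hyl
  apply hii'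
  rw [← chosen_of_lower_bid hSF hPM hIIA hi hb hmin (min_le_left _ _) h₂,
    ← chosen_of_lower_bid hSF hPM hIIA hi' hb hmin (min_le_left _ _) h₃,
    hOnline.flip_unobserved hmin_l]

/-- For a non-degenerate, scale-free, pointwise monotone, IIA,
weakly separated deterministic allocation rule, for each agent `l` and bids `b_{-l}`
of the other agents there is a finite set `S_l(b_{-l}) ⊆ ℝ` containing every bid `b_l`
for which some round is `(b_l, b_{-l}; ρ)`-influential with influencing agent `l`
and not bid-independent w.r.t. `ρ`. -/
theorem counterexample_bids_finite (k T : ℕ) (A : Alloc k T)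
    (hOnline : Online A) (hND : NonDegenerate A) (hSF : ScaleFree A)
    (hPM : PointwiseMonotone A) (hIIA : IIA A) (hWS : WeaklySeparated A)
    (l : Fin k) (b : Fin k → ℝ) (hb : ∀ j, j ≠ l → 0 < b j) :
    ∃ S : Finset ℝ, ∀ (x : ℝ) (ρ : Realization k T) (t : Fin T), 0 < x →
      InfluentialAt A (Function.update b l x) ρ t →
      A (Function.update b l x) ρ t = l →
      ¬ BidIndependent A ρ t →
      x ∈ S := by
  have hfin : (⋃ d : (Realization k T × Fin T × Fin T × Fin k × Fin k), {x : ℝ |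
      (d.2.1 < d.2.2.1 ∧ d.2.2.2.1 ≠ d.2.2.2.2 ∧ ¬ BidIndependent A d.1 d.2.1) ∧
      0 < x ∧ A (Function.update b l x) d.1 d.2.1 = l ∧
      A (Function.update b l x) d.1 d.2.2.1 = d.2.2.2.1 ∧
      A (Function.update b l x) (flip d.1 l d.2.1) d.2.2.1 = d.2.2.2.2}).Finite := by
    refine Set.finite_iUnion fun d => Set.Subsingleton.finite ?_
    rintro x ⟨⟨htt', hne, hBI⟩, hx⟩ x' ⟨-, hx'⟩
    exact influencing_bids_subsingleton hOnline hSF hPM hIIA hWS hne hb htt' hBI hx hx'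
  refine ⟨hfin.toFinset, fun x ρ t hx ⟨t', htt', hne⟩ hl hBI => ?_⟩
  rw [hl] at hne
  rw [Set.Finite.mem_toFinset, Set.mem_iUnion]
  exact ⟨(ρ, t, t', _, _), ⟨htt', hne, hBI⟩, hx, hl, rfl, rfl⟩

end MAB
end
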